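/- Let q be a power of an odd prime, f ∈ 𝔽_q[X] square-free of degree 3, and let D consist of n pairwise distinct affine points P_i = (α_i, β_i) of y² = f(x). Let k be odd with 3 ≤ k ≤ n−2, let 0 ≤ ℓ ≤ (k−3)/2 and η ∈ 𝔽_q^*. Then the k vectors ev_D(x^a) for 0 ≤ a ≤ (k−1)/2, ev_D(x^b y) for 0 ≤ b ≤ (k−3)/2 with b ≠ ℓ, and ev_D(x^ℓ y + η x^{(k+1)/2}) are linearly independent over 𝔽_q; consequently the twisted elliptic curve code C(D, kO, ℓ, η) has dimension k. -/

import Mathlib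

open Polynomial

/-- For `g = c + d y` vanishing at `n` distinct points of `y² = f(x)`, the norm `c² - d² f` has
at least `n` roots, counted with multiplicity. -/
lemma map_le_roots_norm {F ι : Type*} [Field F] [Fintype ι] (hchar : ringChar F ≠ 2)
    {f c d : F[X]} {α β : ι → F} (hdist : Function.Injective (fun i => (α i, β i)))
    (hcurve : ∀ i, β i ^ 2 = f.eval (α i))
    (hzero : ∀ i, c.eval (α i) + d.eval (α i) * β i = 0) (hN : c ^ 2 - d ^ 2 * f ≠ 0) :
    Finset.univ.val.map α ≤ (c ^ 2 - d ^ 2 * f).roots := by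
  classical
  rw [Multiset.le_iff_count]
  intro a
  rw [count_roots, Multiset.count_map]
  change (Finset.univ.filter fun i => a = α i).card ≤ _
  set S := Finset.univ.filter fun i => a = α i with hS
  have hmem : ∀ i, i ∈ S ↔ a = α i := fun i => by simp [hS]
  rw [le_rootMultiplicity_iff hN]
  rcases Nat.lt_or_ge 1 S.card with h2 | h1
  · obtain ⟨i, hi, j, hj, hij⟩ := Finset.one_lt_card.mp h2
    rw [hmem] at hi hj
    have opp : ∀ u v, a = α u → a = α v → u ≠ v → β v = - β u := by
      intro u v hu hv huv
      have hsq : β v ^ 2 = β u ^ 2 := by rw [hcurve, hcurve, ← hu, ← hv]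
      refine (sq_eq_sq_iff_eq_or_eq_neg.mp hsq).resolve_left fun h => huv (hdist ?_)
      simp [← hu, ← hv, h]
    have hβ : β j = - β i := opp i j hi hj hij
    have hcard : S.card ≤ 2 := by
      refine (Finset.card_le_card (t := {i, j}) fun v hv => ?_).trans Finset.card_le_two
      rw [hmem] at hv
      by_contra hne
      simp only [Finset.mem_insert, Finset.mem_singleton, not_or] at hne
      have hv' : β v = β j := by rw [hβ, opp i v hi hv (Ne.symm hne.1)]
      exact hne.2 (hdist (by simp [← hv, ← hj, hv']))
    have htwo : (2 : F) ≠ 0 := Ring.two_ne_zero hchar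
    have hβ0 : β i ≠ 0 := fun h =>
      hij (hdist (by simp [← hi, ← hj, hβ, h]))
    have e1 := hzero i
    have e2 := hzero j
    rw [← hi] at e1
    rw [← hj, hβ] at e2
    have hc : c.eval a = 0 := by
      have : 2 * c.eval a = 0 := by linear_combination e1 + e2
      simpa [htwo] using this
    have hd : d.eval a = 0 := by
      have : d.eval a * β i = 0 := by linear_combination e1 - hc
      simpa [hβ0] using this
    refine (pow_dvd_pow _ hcard).trans (dvd_sub ?_ (Dvd.dvd.mul_right ?_ _))
    · exact pow_dvd_pow_of_dvd (dvd_iff_isRoot.mpr hc) 2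
    · exact pow_dvd_pow_of_dvd (dvd_iff_isRoot.mpr hd) 2
  · rcases S.eq_empty_or_nonempty with h0 | ⟨i, hi⟩
    · simp [h0]
    · rw [hmem] at hi
      refine (pow_dvd_pow _ h1).trans ?_
      rw [pow_one, dvd_iff_isRoot, IsRoot.def, eval_sub, eval_mul, eval_pow, eval_pow, hi,
        ← hcurve]
      linear_combination (c.eval (α i) - d.eval (α i) * β i) * hzero i

/-- Over a domain, the norm form `c² - d² f` is anisotropic when `f` has odd degree. -/
lemma eq_zero_of_sq_eq_sq_mul {F : Type*} [CommRing F] [IsDomain F] {f c d : F[X]}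
    (hodd : Odd f.natDegree) (h : c ^ 2 = d ^ 2 * f) : c = 0 ∧ d = 0 := by
  have hf : f ≠ 0 := by rintro rfl; simp at hodd
  have hd : d = 0 := by
    by_contra hd
    have := congrArg natDegree h
    rw [natDegree_pow, natDegree_mul (pow_ne_zero 2 hd) hf, natDegree_pow] at this
    obtain ⟨r, hr⟩ := hodd
    omega
  exact ⟨by simpa [hd] using h, hd⟩

/-- A function `c + d y` with few poles vanishing at many points of `y² = f(x)` is zero. -/
lemma eq_zero_of_forall_eval_add_eval_mul_eq_zero {F : Type*} [Field F] (hchar : ringChar F ≠ 2)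
    {f c d : F[X]} (hodd : Odd f.natDegree) {n : ℕ} {α β : Fin n → F}
    (hdist : Function.Injective (fun i => (α i, β i)))
    (hcurve : ∀ i, β i ^ 2 = f.eval (α i))
    (hzero : ∀ i, c.eval (α i) + d.eval (α i) * β i = 0)
    (hc : 2 * c.natDegree < n) (hd : 2 * d.natDegree + f.natDegree < n) : c = 0 ∧ d = 0 := by
  refine eq_zero_of_sq_eq_sq_mul hodd (sub_eq_zero.mp ?_)
  by_contra hN
  have h1 := Multiset.card_le_card (map_le_roots_norm hchar hdist hcurve hzero hN)
  have h2 := card_roots' (c ^ 2 - d ^ 2 * f)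
  have h3 := natDegree_sub_le (c ^ 2) (d ^ 2 * f)
  have h4 := natDegree_pow_le (p := c) (n := 2)
  have h5 := natDegree_mul_le (p := d ^ 2) (q := f)
  have h6 := natDegree_pow_le (p := d) (n := 2)
  have h7 : (Finset.univ.val.map α).card = n := by simp
  omega

lemma natDegree_sum_fin_C_mul_X_pow_le {R : Type*} [Semiring R] {m : ℕ} (v : Fin (m + 1) → R) :
    (∑ a, C (v a) * X ^ (a : ℕ)).natDegree ≤ m :=
  natDegree_sum_le_of_forall_le _ _ fun a _ => (natDegree_C_mul_X_pow_le _ _).trans (by omega)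

lemma coeff_sum_fin_C_mul_X_pow {R : Type*} [Semiring R] {m : ℕ} (v : Fin m → R) (a : Fin m) :
    (∑ b, C (v b) * X ^ (b : ℕ)).coeff a = v a := by
  simp [coeff_X_pow, Fin.val_inj]

theorem stmt_4 (F : Type*) [Field F] [Fintype F] (hchar : ringChar F ≠ 2)
    (f : F[X]) (hsf : Squarefree f) (hdeg : f.natDegree = 3)
    (n : ℕ) (α β : Fin n → F)
    (hdist : Function.Injective (fun i => (α i, β i)))
    (hcurve : ∀ i, β i ^ 2 = f.eval (α i))
    (k : ℕ) (hk : Odd k) (hk3 : 3 ≤ k) (hkn : k ≤ n - 2)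
    (ℓ : ℕ) (hℓ : ℓ ≤ (k - 3) / 2) (η : F) (hη : η ≠ 0)
    (e : Fin ((k - 1) / 2 + 1) ⊕ Fin ((k - 3) / 2 + 1) → Fin n → F)
    (he : e = Sum.elim
      (fun (a : Fin ((k - 1) / 2 + 1)) => fun i => α i ^ (a : ℕ))
      (fun (b : Fin ((k - 3) / 2 + 1)) => fun i => α i ^ (b : ℕ) * β i +
        if (b : ℕ) = ℓ then η * α i ^ ((k + 1) / 2) else 0)) :
    LinearIndependent F e ∧
      Module.finrank F ↥(Submodule.span F (Set.range e)) = k := by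
  have hli : LinearIndependent F e := by
    subst he
    rw [Fintype.linearIndependent_iff]
    intro g hg
    obtain ⟨t, ht⟩ : ∃ t, (k - 3) / 2 = t := ⟨_, rfl⟩
    have hs : (k - 1) / 2 = t + 1 := by obtain ⟨r, rfl⟩ := hk; omega
    have hu : (k + 1) / 2 = t + 2 := by obtain ⟨r, rfl⟩ := hk; omega
    have hkt : k = 2 * t + 3 := by obtain ⟨r, rfl⟩ := hk; omega
    let p : F[X] := ∑ a, C (g (Sum.inl a)) * X ^ (a : ℕ)
    let d : F[X] := ∑ b, C (g (Sum.inr b)) * X ^ (b : ℕ)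
    let l : Fin ((k - 3) / 2 + 1) := ⟨ℓ, by omega⟩
    let c : F[X] := p + C (g (Sum.inr l) * η) * X ^ ((k + 1) / 2)
    have hzero : ∀ i, c.eval (α i) + d.eval (α i) * β i = 0 := by
      intro i
      have hi := congrFun hg i
      have hl : ∀ b : Fin ((k - 3) / 2 + 1), (b : ℕ) = ℓ ↔ b = l := fun b => by simp [l, Fin.ext_iff]
      simp only [Fintype.sum_sum_type, Sum.elim_inl, Sum.elim_inr,
        Finset.sum_apply, Pi.smul_apply, smul_eq_mul, Pi.zero_apply, mul_add,
        Finset.sum_add_distrib, hl, mul_ite, mul_zero, Finset.sum_ite_eq', Finset.mem_univ,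
        if_true] at hi
      simp only [c, d, p, eval_add, eval_finsetSum, eval_mul, eval_C, eval_pow, eval_X,
        Finset.sum_mul, mul_assoc]
      linear_combination hi
    have hp : p.natDegree ≤ t + 1 := (natDegree_sum_fin_C_mul_X_pow_le _).trans hs.le
    have hd : d.natDegree ≤ t := (natDegree_sum_fin_C_mul_X_pow_le _).trans ht.le
    have hc : c.natDegree ≤ t + 2 :=
      natDegree_add_le_of_degree_le (by omega) ((natDegree_C_mul_X_pow_le _ _).trans hu.le)
    obtain ⟨hc0, hd0⟩ := eq_zero_of_forall_eval_add_eval_mul_eq_zero hchar (by rw [hdeg]; decide)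
      hdist hcurve hzero (by omega) (by omega)
    have hr : ∀ b, g (Sum.inr b) = 0 := fun b => by
      rw [← coeff_sum_fin_C_mul_X_pow (fun b => g (Sum.inr b)) b]
      exact congrArg (coeff · b) hd0
    have hp0 : p = 0 := by simpa [c, hr] using hc0
    rintro (a | b)
    · rw [← coeff_sum_fin_C_mul_X_pow (fun a => g (Sum.inl a)) a]
      exact congrArg (coeff · a) hp0
    · exact hr b
  refine ⟨hli, ?_⟩
  rw [finrank_span_eq_card hli]
  obtain ⟨r, rfl⟩ := hk
  simp
  omega
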